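/- Assume additionally a₁ ≤ 0 ≤ a_m. For every M > 0 there exist M' > M and C > 0 such that, with θ, ψ₁, ψ₂ defined using the constant M', for all x ∈ ℝ and all t > 0: ∫₀^t ∫_{-∞}^{∞} (t−s)^{−1} Σ_{j=1}^m exp(−(x−y−a_j(t−s))²/(M(t−s))) · ψ₂(y,s)² dy ds ≤ C (θ + ψ₁ + ψ₂)(x,t). -/

import Mathlib

open MeasureTheory Real intervalIntegral

/-- The Gaussian-weight sum `θ`. -/
noncomputable def theta (m : ℕ) (a : Fin m → ℝ) (M' : ℝ) (x t : ℝ) : ℝ :=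
  ∑ j : Fin m, (1 + t) ^ (-(1/2 : ℝ)) * Real.exp (-((x - a j * t) ^ 2 / (M' * t)))

/-- The indicator `χ` of the characteristic cone `[a₁ t, a_m t]`. -/
noncomputable def chi (a1 am x t : ℝ) : ℝ :=
  if a1 * t ≤ x ∧ x ≤ am * t then 1 else 0

/-- The algebraically decaying weight `ψ₁` supported inside the characteristic cone. -/
noncomputable def psi1 (m : ℕ) (a : Fin m → ℝ) (a1 am x t : ℝ) : ℝ :=
  chi a1 am x t *
    ∑ j : Fin m, (1 + |x| + t) ^ (-(1/2 : ℝ)) * (1 + |x - a j * t|) ^ (-(1/2 : ℝ))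

/-- The weight `ψ₂` supported outside the characteristic cone. -/
noncomputable def psi2 (a1 am x t : ℝ) : ℝ :=
  (1 - chi a1 am x t) *
    ((1 + |x - a1 * t| + Real.sqrt t) ^ (-(3/2 : ℝ)) +
      (1 + |x - am * t| + Real.sqrt t) ^ (-(3/2 : ℝ)))

theorem lintegral_affine_eq {f : ℝ → ℝ} (hf : Integrable f) (h0 : ∀ u, 0 ≤ f u) {b : ℝ}
    (hb : b ≠ 0) (D : ℝ) :
    ∫⁻ s, ENNReal.ofReal (f (D + b * s)) = ENNReal.ofReal (|b|⁻¹ * ∫ u, f u) := by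
  have hi : Integrable (fun s => f (D + b * s)) :=
    (hf.comp_add_left D).comp_mul_left' hb
  rw [← ofReal_integral_eq_lintegral_ofReal hi (.of_forall fun s => h0 _)]
  have := Measure.integral_comp_mul_left (fun u => f (D + u)) b
  rw [this, integral_add_left_eq_self f D, abs_inv, smul_eq_mul]

theorem lintegral_gaussian_affine {κ b : ℝ} (hκ : 0 < κ) (hb : b ≠ 0) (D : ℝ) :
    ∫⁻ s, ENNReal.ofReal (exp (-((D + b * s) ^ 2 / κ))) = ENNReal.ofReal (|b|⁻¹ * √(π * κ)) := by
  have h := lintegral_affine_eq (integrable_exp_neg_mul_sq (inv_pos.2 hκ))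
    (fun u => (exp_pos _).le) hb D
  rw [integral_gaussian, div_inv_eq_mul] at h
  rw [← h]
  congr 1 with s
  congr 2
  ring

theorem lintegral_cauchy_affine {p b : ℝ} (hp : 0 < p) (hb : b ≠ 0) (D : ℝ) :
    ∫⁻ s, ENNReal.ofReal ((p ^ 2 + (D + b * s) ^ 2)⁻¹) = ENNReal.ofReal (π / (p * |b|)) := by
  have h := lintegral_affine_eq integrable_inv_one_add_sq
    (fun u => by positivity) (div_ne_zero hb hp.ne') (D / p)
  rw [integral_univ_inv_one_add_sq] at h
  have e : ∀ s, ENNReal.ofReal ((p ^ 2 + (D + b * s) ^ 2)⁻¹) =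
      ENNReal.ofReal ((p ^ 2)⁻¹) * ENNReal.ofReal ((1 + (D / p + b / p * s) ^ 2)⁻¹) := by
    intro s
    rw [← ENNReal.ofReal_mul (by positivity), ← mul_inv]
    congr 2
    field_simp
  simp_rw [e]
  rw [lintegral_const_mul _ (by fun_prop), h, ← ENNReal.ofReal_mul (by positivity)]
  congr 1
  rw [abs_div, abs_of_pos hp]
  have := abs_pos.2 hb
  field_simp

theorem lintegral_inv_sqrt {t : ℝ} (ht : 0 < t) :
    ∫⁻ s in Set.Ioo 0 t, ENNReal.ofReal ((√s)⁻¹) = ENNReal.ofReal (2 * √t) := by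
  have hI := intervalIntegral.intervalIntegrable_rpow' (a := 0) (b := t) (r := -(1/2 : ℝ)) (by norm_num)
  have hv := integral_rpow (a := 0) (b := t) (r := -(1/2 : ℝ)) (Or.inl (by norm_num))
  rw [intervalIntegrable_iff_integrableOn_Ioo_of_le ht.le] at hI
  rw [intervalIntegral.integral_of_le ht.le, integral_Ioc_eq_integral_Ioo] at hv
  have e : ∀ s ∈ Set.Ioo 0 t, ENNReal.ofReal ((√s)⁻¹) = ENNReal.ofReal (s ^ (-(1/2 : ℝ))) := by
    intro s hs
    rw [rpow_neg hs.1.le, sqrt_eq_rpow]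
  rw [setLIntegral_congr_fun measurableSet_Ioo e, ← ofReal_integral_eq_lintegral_ofReal hI ?_, hv]
  · congr 1
    rw [sqrt_eq_rpow]
    norm_num
    ring
  · filter_upwards [ae_restrict_mem measurableSet_Ioo] with s hs
    exact rpow_nonneg hs.1.le _

theorem lintegral_inv_sqrt_sub {t : ℝ} (ht : 0 < t) :
    ∫⁻ s in Set.Ioo 0 t, ENNReal.ofReal ((√(t - s))⁻¹) = ENNReal.ofReal (2 * √t) := by
  rw [← lintegral_inv_sqrt ht, ← lintegral_indicator measurableSet_Ioo,
    ← lintegral_indicator measurableSet_Ioo,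
    ← lintegral_sub_left_eq_self (μ := volume) ((Set.Ioo 0 t).indicator _) t]
  congr 1 with s
  by_cases h : s ∈ Set.Ioo 0 t
  · rw [Set.indicator_of_mem h, Set.indicator_of_mem (by simpa [and_comm] using h),
      sub_sub_cancel]
  · rw [Set.indicator_of_notMem h, Set.indicator_of_notMem (by simpa [and_comm] using h)]

/-- `∫₀^∞ (c² + s)^{-3/2} ds = 2 / c`. -/
theorem lintegral_rpow_shift {c t : ℝ} (hc : 0 < c) :
    ∫⁻ s in Set.Ioo 0 t, ENNReal.ofReal ((√(c ^ 2 + s) ^ 3)⁻¹) ≤ ENNReal.ofReal (2 / c) := by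
  have hc2 : 0 < c ^ 2 := by positivity
  have hI := integrableOn_Ioi_rpow_of_lt (a := -(3/2 : ℝ)) (by norm_num) hc2
  have hv := integral_Ioi_rpow_of_lt (a := -(3/2 : ℝ)) (by norm_num) hc2
  have e : ∀ s ∈ Set.Ioi (c ^ 2), ENNReal.ofReal ((√s ^ 3)⁻¹) = ENNReal.ofReal (s ^ (-(3/2 : ℝ))) := by
    intro s hs
    have hs' : 0 ≤ s := hc2.le.trans (le_of_lt hs)
    rw [rpow_neg hs', sqrt_eq_rpow, ← rpow_natCast, ← rpow_mul hs']
    norm_num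
  calc ∫⁻ s in Set.Ioo 0 t, ENNReal.ofReal ((√(c ^ 2 + s) ^ 3)⁻¹)
      ≤ ∫⁻ s in Set.Ioi 0, ENNReal.ofReal ((√(c ^ 2 + s) ^ 3)⁻¹) :=
        lintegral_mono_set Set.Ioo_subset_Ioi_self
    _ = ∫⁻ s in Set.Ioi (c ^ 2), ENNReal.ofReal ((√s ^ 3)⁻¹) := by
        rw [← lintegral_indicator measurableSet_Ioi, ← lintegral_indicator measurableSet_Ioi,
          ← lintegral_add_left_eq_self (μ := volume) ((Set.Ioi (c ^ 2)).indicator _) (c ^ 2)]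
        congr 1 with s
        by_cases h : s ∈ Set.Ioi (0 : ℝ)
        · rw [Set.indicator_of_mem h, Set.indicator_of_mem (by simpa using h)]
        · rw [Set.indicator_of_notMem h, Set.indicator_of_notMem (by simpa using h)]
    _ = ENNReal.ofReal (2 / c) := by
        rw [setLIntegral_congr_fun measurableSet_Ioi e,
          ← ofReal_integral_eq_lintegral_ofReal hI ?_, hv]
        · congr 1
          norm_num
          rw [← rpow_natCast, ← rpow_mul hc.le]
          norm_num
          rw [rpow_neg_one]
          ring
        · filter_upwards [ae_restrict_mem measurableSet_Ioi] with s hs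
          exact rpow_nonneg (hc2.le.trans (le_of_lt hs)) _

/-- A majorant of the convolution in `y`, as a function of the offset
`E = x - α (t - s) - β s` between the two centres. -/
noncomputable def convMajorant (M t E s : ℝ) : ℝ :=
  (√(1 + t))⁻¹ * (√(t - s))⁻¹ * (1 + s)⁻¹ * exp (-(E ^ 2 / (8 * (M * (t - s))))) +
    (√(t - s))⁻¹ * ((1 + |E| + √s) ^ 3)⁻¹

theorem inv_cube_le_cauchy {p : ℝ} (hp : 0 < p) (z : ℝ) :
    ((p + |z|) ^ 3)⁻¹ ≤ p⁻¹ * (p ^ 2 + z ^ 2)⁻¹ := by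
  rw [← mul_inv]
  apply inv_anti₀ (by positivity)
  rw [← sq_abs z]
  have := abs_nonneg z
  have h : p * |z| ^ 2 ≤ (p + |z|) * |z| ^ 2 := by gcongr; linarith
  nlinarith [mul_nonneg (mul_nonneg hp.le hp.le) this, mul_nonneg hp.le (sq_nonneg |z|)]

theorem gaussian_mul_inv_cube_le {E z κ r : ℝ} (hκ : 0 < κ) (hr : 0 ≤ r) :
    exp (-((E - z) ^ 2 / κ)) * ((1 + |z| + r) ^ 3)⁻¹ ≤
      exp (-(E ^ 2 / (8 * κ))) * exp (-((E - z) ^ 2 / (2 * κ))) * ((1 + |z| + r) ^ 3)⁻¹ +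
        8 * ((1 + |E| + r) ^ 3)⁻¹ * exp (-((E - z) ^ 2 / κ)) := by
  have hz := abs_nonneg z
  have hE := abs_nonneg E
  rcases le_total (2 * |z|) |E| with h | h
  · have h1 : E ^ 2 / 4 ≤ (E - z) ^ 2 := by
      have h2 : |E| / 2 ≤ |E - z| := by
        have := abs_sub_abs_le_abs_sub E z
        linarith
      have h3 : (|E| / 2) ^ 2 ≤ |E - z| ^ 2 := by gcongr
      rw [sq_abs, div_pow, sq_abs] at h3
      linarith
    have h4 : exp (-((E - z) ^ 2 / κ)) ≤
        exp (-(E ^ 2 / (8 * κ))) * exp (-((E - z) ^ 2 / (2 * κ))) := by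
      rw [← exp_add, exp_le_exp]
      have e : E ^ 2 / (8 * κ) = (E ^ 2 / 4) / (2 * κ) := by field_simp; ring
      have e2 : (E - z) ^ 2 / κ = (E - z) ^ 2 / (2 * κ) + (E - z) ^ 2 / (2 * κ) := by
        field_simp; norm_num
      have : (E ^ 2 / 4) / (2 * κ) ≤ (E - z) ^ 2 / (2 * κ) := by gcongr
      linarith
    have h5 : exp (-((E - z) ^ 2 / κ)) * ((1 + |z| + r) ^ 3)⁻¹ ≤
      exp (-(E ^ 2 / (8 * κ))) * exp (-((E - z) ^ 2 / (2 * κ))) * ((1 + |z| + r) ^ 3)⁻¹ := by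
      gcongr
    have : 0 ≤ 8 * ((1 + |E| + r) ^ 3)⁻¹ * exp (-((E - z) ^ 2 / κ)) := by positivity
    linarith
  · have h1 : ((1 + |z| + r) ^ 3)⁻¹ ≤ 8 * ((1 + |E| + r) ^ 3)⁻¹ := by
      have : 8 * ((1 + |E| + r) ^ 3)⁻¹ = (((1 + |E| + r) / 2) ^ 3)⁻¹ := by
        rw [div_pow, inv_div]; ring
      rw [this]
      apply inv_anti₀ (by positivity)
      gcongr
      linarith
    have h2 : 0 ≤ exp (-(E ^ 2 / (8 * κ))) * exp (-((E - z) ^ 2 / (2 * κ))) *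
      ((1 + |z| + r) ^ 3)⁻¹ := by positivity
    have := mul_le_mul_of_nonneg_left h1 (exp_pos (-((E - z) ^ 2 / κ))).le
    linarith

theorem lintegral_gaussian_conv_le {M : ℝ} (hM : 0 < M) {s t : ℝ} (hs : 0 < s) (hst : s < t)
    (x α β : ℝ) :
    ∫⁻ y, ENNReal.ofReal ((t - s)⁻¹ * (exp (-((x - y - α * (t - s)) ^ 2 / (M * (t - s)))) *
        ((1 + |y - β * s| + √s) ^ 3)⁻¹)) ≤
      ENNReal.ofReal ((2 * π + 2 * √(2 * π * M) + 8 * √(π * M)) *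
        convMajorant M t (x - α * (t - s) - β * s) s) := by
  set E := x - α * (t - s) - β * s with hE
  have hT : 0 < t - s := sub_pos.2 hst
  set T := t - s with hTdef
  have hκ : 0 < M * T := mul_pos hM hT
  have hts : 1 + t = T + (1 + s) := by rw [hTdef]; ring
  have hrT : 0 < √T := sqrt_pos.2 hT
  have hTT : T⁻¹ = (√T)⁻¹ * (√T)⁻¹ := by rw [← mul_inv, mul_self_sqrt hT.le]
  have hr1t : 0 < √(1 + t) := sqrt_pos.2 (by linarith)
  have hss := sq_sqrt hs.le
  have hrs := sqrt_nonneg s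
  -- the far part
  have hfar : ∫⁻ y, ENNReal.ofReal (T⁻¹ * (8 * ((1 + |E| + √s) ^ 3)⁻¹ *
      exp (-((x - α * T + (-1) * y) ^ 2 / (M * T))))) =
      ENNReal.ofReal (8 * √(π * M) * ((√T)⁻¹ * ((1 + |E| + √s) ^ 3)⁻¹)) := by
    simp_rw [← mul_assoc]
    simp_rw [ENNReal.ofReal_mul (show 0 ≤ T⁻¹ * 8 * ((1 + |E| + √s) ^ 3)⁻¹ by positivity)]
    rw [lintegral_const_mul _ (by fun_prop), lintegral_gaussian_affine hκ (by norm_num),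
      ← ENNReal.ofReal_mul (by positivity)]
    congr 1
    rw [hTT, ← mul_assoc π, sqrt_mul (by positivity)]
    norm_num
    field_simp
  -- the near part
  have hnear : ∫⁻ y, ENNReal.ofReal (T⁻¹ * (exp (-(E ^ 2 / (8 * (M * T)))) *
      exp (-((x - α * T + (-1) * y) ^ 2 / (2 * (M * T)))) * ((1 + |y - β * s| + √s) ^ 3)⁻¹)) ≤
      ENNReal.ofReal ((2 * π + 2 * √(2 * π * M)) *
        ((√(1 + t))⁻¹ * (√T)⁻¹ * (1 + s)⁻¹ * exp (-(E ^ 2 / (8 * (M * T)))))) := by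
    rcases le_total (1 + s) T with h | h
    · have hq : (√T)⁻¹ ≤ 2 * (√(1 + t))⁻¹ := by
        have : √(1 + t) ≤ 2 * √T := by
          apply sqrt_le_iff.2 ⟨by positivity, ?_⟩
          rw [mul_pow, sq_sqrt hT.le]; linarith
        rw [← div_eq_mul_inv, le_div_iff₀ hr1t, inv_mul_le_iff₀ hrT]
        linarith
      calc _ ≤ ∫⁻ y, ENNReal.ofReal (T⁻¹ * exp (-(E ^ 2 / (8 * (M * T)))) * (1 + √s)⁻¹) *
            ENNReal.ofReal (((1 + √s) ^ 2 + (-(β * s) + 1 * y) ^ 2)⁻¹) := by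
            refine lintegral_mono fun y => ?_
            rw [← ENNReal.ofReal_mul (by positivity)]
            apply ENNReal.ofReal_le_ofReal
            have h1 := inv_cube_le_cauchy (p := 1 + √s) (by positivity) (y - β * s)
            have h2 : exp (-((x - α * T + (-1) * y) ^ 2 / (2 * (M * T)))) ≤ 1 := by
              apply exp_le_one_iff.2
              have : 0 ≤ (x - α * T + (-1) * y) ^ 2 / (2 * (M * T)) := by positivity
              linarith
            have e1 : 1 + |y - β * s| + √s = 1 + √s + |y - β * s| := by ring
            have e2 : -(β * s) + 1 * y = y - β * s := by ring
            rw [e1, e2]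
            calc _ ≤ T⁻¹ * (exp (-(E ^ 2 / (8 * (M * T)))) * 1 *
                  ((1 + √s)⁻¹ * ((1 + √s) ^ 2 + (y - β * s) ^ 2)⁻¹)) := by gcongr
              _ = _ := by ring
        _ = ENNReal.ofReal (T⁻¹ * exp (-(E ^ 2 / (8 * (M * T)))) * (1 + √s)⁻¹ *
              (π / ((1 + √s) * |1|))) := by
            rw [lintegral_const_mul _ (by fun_prop),
              lintegral_cauchy_affine (by positivity) one_ne_zero,
              ← ENNReal.ofReal_mul (by positivity)]
        _ ≤ _ := by
            apply ENNReal.ofReal_le_ofReal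
            have h3 : (1 + √s)⁻¹ * (1 + √s)⁻¹ ≤ (1 + s)⁻¹ := by
              rw [← mul_inv]
              apply inv_anti₀ (by positivity)
              nlinarith
            rw [abs_one, mul_one]
            calc _ = π * (√T)⁻¹ * ((√T)⁻¹) * ((1 + √s)⁻¹ * (1 + √s)⁻¹) *
                  exp (-(E ^ 2 / (8 * (M * T)))) := by rw [hTT]; ring
              _ ≤ π * (2 * (√(1 + t))⁻¹) * ((√T)⁻¹) * (1 + s)⁻¹ *
                  exp (-(E ^ 2 / (8 * (M * T)))) := by gcongr
              _ = (2 * π) * ((√(1 + t))⁻¹ * (√T)⁻¹ * (1 + s)⁻¹ *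
                  exp (-(E ^ 2 / (8 * (M * T))))) := by ring
              _ ≤ _ := by gcongr; linarith [sqrt_nonneg (2 * π * M)]
    · have hq : (√(1 + s))⁻¹ ≤ 2 * (√(1 + t))⁻¹ := by
        have : √(1 + t) ≤ 2 * √(1 + s) := by
          apply sqrt_le_iff.2 ⟨by positivity, ?_⟩
          rw [mul_pow, sq_sqrt (by linarith)]; linarith
        rw [← div_eq_mul_inv, le_div_iff₀ hr1t, inv_mul_le_iff₀ (by positivity)]
        linarith
      calc _ ≤ ∫⁻ y, ENNReal.ofReal (T⁻¹ * exp (-(E ^ 2 / (8 * (M * T)))) *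
              ((1 + s)⁻¹ * (√(1 + s))⁻¹)) *
            ENNReal.ofReal (exp (-((x - α * T + (-1) * y) ^ 2 / (2 * (M * T))))) := by
            refine lintegral_mono fun y => ?_
            rw [← ENNReal.ofReal_mul (by positivity)]
            apply ENNReal.ofReal_le_ofReal
            have h1 : ((1 + |y - β * s| + √s) ^ 3)⁻¹ ≤ (1 + s)⁻¹ * (√(1 + s))⁻¹ := by
              rw [← mul_inv]
              apply inv_anti₀ (by positivity)
              have h4 : √(1 + s) ≤ 1 + |y - β * s| + √s := by
                apply sqrt_le_iff.2 ⟨by positivity, ?_⟩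
                have := abs_nonneg (y - β * s)
                nlinarith [mul_nonneg this hrs]
              calc (1 + s) * √(1 + s) = √(1 + s) ^ 3 := by
                    rw [pow_succ, sq_sqrt (by linarith)]
                _ ≤ _ := by gcongr
            calc _ ≤ T⁻¹ * (exp (-(E ^ 2 / (8 * (M * T)))) *
                  exp (-((x - α * T + (-1) * y) ^ 2 / (2 * (M * T)))) *
                  ((1 + s)⁻¹ * (√(1 + s))⁻¹)) := by gcongr
              _ = _ := by ring
        _ = ENNReal.ofReal (T⁻¹ * exp (-(E ^ 2 / (8 * (M * T)))) *
              ((1 + s)⁻¹ * (√(1 + s))⁻¹) * (√(2 * π * M) * √T)) := by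
            rw [lintegral_const_mul _ (by fun_prop),
              lintegral_gaussian_affine (by positivity) (by norm_num),
              ← ENNReal.ofReal_mul (by positivity), ← sqrt_mul (by positivity), abs_neg, abs_one,
              inv_one, one_mul, show π * (2 * (M * T)) = 2 * π * M * T by ring]
        _ ≤ _ := by
            apply ENNReal.ofReal_le_ofReal
            calc _ = √(2 * π * M) * (√(1 + s))⁻¹ * (√T)⁻¹ * (1 + s)⁻¹ *
                  exp (-(E ^ 2 / (8 * (M * T)))) := by rw [hTT]; field_simp
              _ ≤ √(2 * π * M) * (2 * (√(1 + t))⁻¹) * (√T)⁻¹ * (1 + s)⁻¹ *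
                  exp (-(E ^ 2 / (8 * (M * T)))) := by gcongr
              _ = (2 * √(2 * π * M)) * ((√(1 + t))⁻¹ * (√T)⁻¹ * (1 + s)⁻¹ *
                  exp (-(E ^ 2 / (8 * (M * T))))) := by ring
              _ ≤ _ := by gcongr; linarith [pi_pos]
  calc _ ≤ ∫⁻ y, (ENNReal.ofReal (T⁻¹ * (exp (-(E ^ 2 / (8 * (M * T)))) *
      exp (-((x - α * T + (-1) * y) ^ 2 / (2 * (M * T)))) * ((1 + |y - β * s| + √s) ^ 3)⁻¹)) +
      ENNReal.ofReal (T⁻¹ * (8 * ((1 + |E| + √s) ^ 3)⁻¹ *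
      exp (-((x - α * T + (-1) * y) ^ 2 / (M * T)))))) := by
        refine lintegral_mono fun y => ?_
        rw [← ENNReal.ofReal_add (by positivity) (by positivity), ← mul_add]
        apply ENNReal.ofReal_le_ofReal
        have := gaussian_mul_inv_cube_le (E := E) (z := y - β * s) hκ hrs
        have e1 : E - (y - β * s) = x - α * T + (-1) * y := by rw [hE]; ring
        have e2 : x - y - α * T = x - α * T + (-1) * y := by ring
        rw [e1] at this
        rw [e2]
        gcongr
    _ ≤ _ := by
        rw [lintegral_add_right _ (by fun_prop), hfar]
        refine (add_le_add_left hnear _).trans ?_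
        rw [← ENNReal.ofReal_add (by positivity) (by positivity)]
        apply ENNReal.ofReal_le_ofReal
        rw [convMajorant, ← hTdef, add_mul (2 * π + 2 * √(2 * π * M)), mul_add, mul_add]
        have h1 : 0 ≤ (2 * π + 2 * √(2 * π * M)) * ((√T)⁻¹ * ((1 + |E| + √s) ^ 3)⁻¹) := by
          positivity
        have h2 : 0 ≤ 8 * √(π * M) * ((√(1 + t))⁻¹ * (√T)⁻¹ * (1 + s)⁻¹ *
          exp (-(E ^ 2 / (8 * (M * T))))) := by positivity
        linarith

theorem lintegral_inv_sqrt_mul_inv_le {t : ℝ} (ht : 0 < t) :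
    ∫⁻ s in Set.Ioo 0 t, ENNReal.ofReal ((√(t - s))⁻¹ * (1 + s)⁻¹) ≤ ENNReal.ofReal 4 := by
  have hrt : 0 < √t := sqrt_pos.2 ht
  calc _ ≤ ∫⁻ s in Set.Ioo 0 t, (ENNReal.ofReal ((√t)⁻¹) * ENNReal.ofReal ((√s)⁻¹) +
        ENNReal.ofReal ((√t)⁻¹) * ENNReal.ofReal ((√(t - s))⁻¹)) := by
        refine setLIntegral_mono' measurableSet_Ioo fun s hs => ?_
        rw [← ENNReal.ofReal_mul (by positivity), ← ENNReal.ofReal_mul (by positivity),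
          ← ENNReal.ofReal_add (by positivity) (by positivity)]
        apply ENNReal.ofReal_le_ofReal
        have h1 : 0 < √s := sqrt_pos.2 hs.1
        have h2 : 0 < √(t - s) := sqrt_pos.2 (sub_pos.2 hs.2)
        have h3 : √t ≤ √s + √(t - s) := by
          refine sqrt_le_iff.2 ⟨by positivity, ?_⟩
          nlinarith [sq_sqrt hs.1.le, sq_sqrt (sub_pos.2 hs.2).le, mul_pos h1 h2]
        have h4 : (1 + s)⁻¹ ≤ (√s)⁻¹ := by
          apply inv_anti₀ h1
          nlinarith [sq_sqrt hs.1.le]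
        calc _ ≤ (√(t - s))⁻¹ * (√s)⁻¹ := by gcongr
          _ = (√t)⁻¹ * √t * (√(t - s))⁻¹ * (√s)⁻¹ := by field_simp
          _ ≤ (√t)⁻¹ * (√s + √(t - s)) * (√(t - s))⁻¹ * (√s)⁻¹ := by gcongr
          _ = _ := by field_simp; ring
    _ = ENNReal.ofReal 4 := by
        rw [lintegral_add_left (by fun_prop), lintegral_const_mul _ (by fun_prop),
          lintegral_const_mul _ (by fun_prop), lintegral_inv_sqrt ht, lintegral_inv_sqrt_sub ht,
          ← ENNReal.ofReal_mul (by positivity), ← ENNReal.ofReal_add (by positivity) (by positivity)]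
        congr 1
        field_simp
        norm_num

theorem sqrt_one_add_le_one_add {s c : ℝ} (hs : 0 ≤ s) (hc : 0 ≤ c) : √(1 + s) ≤ 1 + c + √s := by
  have hr := sqrt_nonneg s
  refine sqrt_le_iff.2 ⟨by positivity, ?_⟩
  nlinarith [sq_sqrt hs, mul_nonneg hc hr]

theorem inv_cube_le_inv_sqrt_cube {s c : ℝ} (hs : 0 ≤ s) (hc : 0 ≤ c) :
    ((1 + c + √s) ^ 3)⁻¹ ≤ (√(1 + s) ^ 3)⁻¹ := by
  apply inv_anti₀ (by positivity)
  have := sqrt_one_add_le_one_add hs hc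
  gcongr

theorem lintegral_convMajorant_le {M t : ℝ} (hM : 0 < M) (ht : 0 < t) (E : ℝ → ℝ) :
    ∫⁻ s in Set.Ioo 0 t, ENNReal.ofReal (convMajorant M t (E s) s) ≤
      ENNReal.ofReal (10 * (√(1 + t))⁻¹) := by
  have hr : 0 < √(1 + t) := sqrt_pos.2 (by linarith)
  calc _ ≤ ∫⁻ s in Set.Ioo 0 t,
        (ENNReal.ofReal (2 * (√(1 + t))⁻¹) * ENNReal.ofReal ((√(t - s))⁻¹ * (1 + s)⁻¹) +
        ENNReal.ofReal ((√(1 + t))⁻¹) * ENNReal.ofReal ((√(1 ^ 2 + s) ^ 3)⁻¹)) := by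
        refine setLIntegral_mono' measurableSet_Ioo fun s hs => ?_
        have hs0 := hs.1
        have hT : 0 < t - s := sub_pos.2 hs.2
        rw [← ENNReal.ofReal_mul (by positivity), ← ENNReal.ofReal_mul (by positivity),
          ← ENNReal.ofReal_add (by positivity) (by positivity)]
        apply ENNReal.ofReal_le_ofReal
        have h2 : 0 < √(t - s) := sqrt_pos.2 hT
        have h1 : 0 < √(1 + s) := sqrt_pos.2 (by linarith)
        have h3 : √(1 + t) ≤ √(1 + s) + √(t - s) := by
          refine sqrt_le_iff.2 ⟨by positivity, ?_⟩
          nlinarith [sq_sqrt (show 0 ≤ 1 + s by linarith), sq_sqrt hT.le, mul_pos h1 h2]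
        have h4 : exp (-(E s ^ 2 / (8 * (M * (t - s))))) ≤ 1 := by
          apply exp_le_one_iff.2
          have : 0 ≤ E s ^ 2 / (8 * (M * (t - s))) := by positivity
          linarith
        have h5 := inv_cube_le_inv_sqrt_cube hs0.le (abs_nonneg (E s))
        have h6 : (√(t - s))⁻¹ * (√(1 + s) ^ 3)⁻¹ ≤
            (√(1 + t))⁻¹ * ((√(1 + s) ^ 3)⁻¹ + (√(t - s))⁻¹ * (1 + s)⁻¹) := by
          have e : (1 + s)⁻¹ = (√(1 + s) ^ 3)⁻¹ * √(1 + s) := by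
            nth_rewrite 1 [← sq_sqrt (show 0 ≤ 1 + s by linarith)]
            field_simp
          calc _ = (√(1 + t))⁻¹ * √(1 + t) * (√(t - s))⁻¹ * (√(1 + s) ^ 3)⁻¹ := by field_simp
            _ ≤ (√(1 + t))⁻¹ * (√(1 + s) + √(t - s)) * (√(t - s))⁻¹ * (√(1 + s) ^ 3)⁻¹ := by
                gcongr
            _ = _ := by rw [e]; field_simp; ring
        rw [convMajorant, one_pow]
        calc _ ≤ (√(1 + t))⁻¹ * (√(t - s))⁻¹ * (1 + s)⁻¹ * 1 +
              (√(t - s))⁻¹ * (√(1 + s) ^ 3)⁻¹ := by gcongr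
          _ ≤ (√(1 + t))⁻¹ * (√(t - s))⁻¹ * (1 + s)⁻¹ * 1 +
              (√(1 + t))⁻¹ * ((√(1 + s) ^ 3)⁻¹ + (√(t - s))⁻¹ * (1 + s)⁻¹) := by gcongr
          _ = _ := by ring
    _ ≤ ENNReal.ofReal (2 * (√(1 + t))⁻¹) * ENNReal.ofReal 4 +
        ENNReal.ofReal ((√(1 + t))⁻¹) * ENNReal.ofReal (2 / 1) := by
        rw [lintegral_add_left (by fun_prop), lintegral_const_mul _ (by fun_prop),
          lintegral_const_mul _ (by fun_prop)]
        gcongr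
        · exact lintegral_inv_sqrt_mul_inv_le ht
        · exact lintegral_rpow_shift one_pos
    _ = _ := by
        rw [← ENNReal.ofReal_mul (by positivity), ← ENNReal.ofReal_mul (by positivity),
          ← ENNReal.ofReal_add (by positivity) (by positivity)]
        congr 1; ring

theorem exp_neg_div_le {M t s c E : ℝ} (hM : 0 < M) (hc : 0 < c) (hs : 0 ≤ s) (hst : s < t) :
    exp (-(E ^ 2 / (c * (M * (t - s))))) ≤ exp (-(E ^ 2 / (c * (M * t)))) := by
  have hT : 0 < t - s := sub_pos.2 hst
  rw [exp_le_exp]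
  have : E ^ 2 / (c * (M * t)) ≤ E ^ 2 / (c * (M * (t - s))) := by
    gcongr
    linarith
  linarith

theorem lintegral_convMajorant_le_of_le_abs {M t d : ℝ} (hM : 0 < M) (ht : 0 < t) (hd : 0 ≤ d)
    (E : ℝ → ℝ) (hE : ∀ s ∈ Set.Ioo 0 t, d ≤ |E s|) :
    ∫⁻ s in Set.Ioo 0 t, ENNReal.ofReal (convMajorant M t (E s) s) ≤
      ENNReal.ofReal (4 * ((√(1 + t))⁻¹ * exp (-(d ^ 2 / (8 * (M * t))))) +
        2 * (√t * ((1 + d) ^ 3)⁻¹)) := by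
  calc _ ≤ ∫⁻ s in Set.Ioo 0 t,
        (ENNReal.ofReal ((√(1 + t))⁻¹ * exp (-(d ^ 2 / (8 * (M * t))))) *
          ENNReal.ofReal ((√(t - s))⁻¹ * (1 + s)⁻¹) +
        ENNReal.ofReal (((1 + d) ^ 3)⁻¹) * ENNReal.ofReal ((√(t - s))⁻¹)) := by
        refine setLIntegral_mono' measurableSet_Ioo fun s hs => ?_
        have hs0 := hs.1
        have hT : 0 < t - s := sub_pos.2 hs.2
        have hEs := hE s hs
        rw [← ENNReal.ofReal_mul (by positivity), ← ENNReal.ofReal_mul (by positivity),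
          ← ENNReal.ofReal_add (by positivity) (by positivity)]
        apply ENNReal.ofReal_le_ofReal
        have h1 : exp (-(E s ^ 2 / (8 * (M * (t - s))))) ≤ exp (-(d ^ 2 / (8 * (M * t)))) := by
          refine (exp_neg_div_le hM (by norm_num) hs0.le hs.2).trans ?_
          rw [exp_le_exp, ← sq_abs (E s)]
          have : d ^ 2 / (8 * (M * t)) ≤ |E s| ^ 2 / (8 * (M * t)) := by gcongr
          linarith
        have h2 : ((1 + |E s| + √s) ^ 3)⁻¹ ≤ ((1 + d) ^ 3)⁻¹ := by
          apply inv_anti₀ (by positivity)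
          have : 1 + d ≤ 1 + |E s| + √s := by linarith [sqrt_nonneg s]
          gcongr
        rw [convMajorant]
        calc _ ≤ (√(1 + t))⁻¹ * (√(t - s))⁻¹ * (1 + s)⁻¹ * exp (-(d ^ 2 / (8 * (M * t)))) +
              (√(t - s))⁻¹ * ((1 + d) ^ 3)⁻¹ := by gcongr
          _ = _ := by ring
    _ ≤ ENNReal.ofReal ((√(1 + t))⁻¹ * exp (-(d ^ 2 / (8 * (M * t))))) * ENNReal.ofReal 4 +
        ENNReal.ofReal (((1 + d) ^ 3)⁻¹) * ENNReal.ofReal (2 * √t) := by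
        rw [lintegral_add_left (by fun_prop), lintegral_const_mul _ (by fun_prop),
          lintegral_const_mul _ (by fun_prop), lintegral_inv_sqrt_sub ht]
        gcongr
        exact lintegral_inv_sqrt_mul_inv_le ht
    _ = _ := by
        rw [← ENNReal.ofReal_mul (by positivity), ← ENNReal.ofReal_mul (by positivity),
          ← ENNReal.ofReal_add (by positivity) (by positivity)]
        congr 1; ring

/-- The resonant contribution: times `s` at which `D + b s` is small compared with `D`. -/
theorem lintegral_resonant_le {M t b D : ℝ} (hM : 0 < M) (ht : 1 ≤ t) (hD : √t ≤ |D|) :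
    ∫⁻ s, ENNReal.ofReal (2 * ((√(1 + t))⁻¹ * (√t)⁻¹ * (2 * |b| / |D|) *
        exp (-((D + b * s) ^ 2 / (8 * (M * t)))) +
        (√t)⁻¹ * ((√(|D| / (2 * |b|)))⁻¹ *
          (√(|D| / (2 * |b|)) ^ 2 + (D + b * s) ^ 2)⁻¹))) ≤
      ENNReal.ofReal ((8 * √(8 * π * M) + 8 * π) * (1 + t)⁻¹) := by
  have ht0 : 0 < t := by linarith
  have hrt : 0 < √t := sqrt_pos.2 ht0
  have hDp : 0 < |D| := hrt.trans_le hD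
  rcases eq_or_ne b 0 with rfl | hb
  · simp
  have hbp : 0 < |b| := abs_pos.2 hb
  set p := √(|D| / (2 * |b|)) with hp
  have hpp : 0 < p := sqrt_pos.2 (by positivity)
  have hp2 : p ^ 2 = |D| / (2 * |b|) := sq_sqrt (by positivity)
  have htt : √t * √t = t := mul_self_sqrt ht0.le
  have hrr : √t ≤ √(1 + t) := sqrt_le_sqrt (by linarith)
  have hti : (√t)⁻¹ * (√t)⁻¹ ≤ 2 * (1 + t)⁻¹ := by
    rw [← mul_inv, htt, ← div_eq_mul_inv, le_div_iff₀ (by linarith), inv_mul_le_iff₀ ht0]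
    linarith
  calc _ = ∫⁻ s, (ENNReal.ofReal (2 * ((√(1 + t))⁻¹ * (√t)⁻¹ * (2 * |b| / |D|))) *
          ENNReal.ofReal (exp (-((D + b * s) ^ 2 / (8 * (M * t))))) +
        ENNReal.ofReal (2 * ((√t)⁻¹ * p⁻¹)) *
          ENNReal.ofReal ((p ^ 2 + (D + b * s) ^ 2)⁻¹)) := by
        congr 1 with s
        rw [← ENNReal.ofReal_mul (by positivity), ← ENNReal.ofReal_mul (by positivity),
          ← ENNReal.ofReal_add (by positivity) (by positivity)]
        congr 1; ring
    _ = ENNReal.ofReal (2 * ((√(1 + t))⁻¹ * (√t)⁻¹ * (2 * |b| / |D|)) *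
          (|b|⁻¹ * (√(8 * π * M) * √t)) + 2 * ((√t)⁻¹ * p⁻¹) * (π / (p * |b|))) := by
        rw [lintegral_add_left (by fun_prop), lintegral_const_mul _ (by fun_prop),
          lintegral_const_mul _ (by fun_prop), lintegral_gaussian_affine (by positivity) hb,
          lintegral_cauchy_affine hpp hb, ← ENNReal.ofReal_mul (by positivity),
          ← ENNReal.ofReal_mul (by positivity),
          ← ENNReal.ofReal_add (by positivity) (by positivity), ← sqrt_mul (by positivity),
          show π * (8 * (M * t)) = 8 * π * M * t by ring]
    _ ≤ _ := by
        apply ENNReal.ofReal_le_ofReal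
        have h1 : |D|⁻¹ ≤ (√t)⁻¹ := inv_anti₀ hrt hD
        have h2 : (√(1 + t))⁻¹ ≤ (√t)⁻¹ := inv_anti₀ hrt hrr
        have e1 : 2 * ((√(1 + t))⁻¹ * (√t)⁻¹ * (2 * |b| / |D|)) * (|b|⁻¹ * (√(8 * π * M) * √t)) =
            4 * √(8 * π * M) * ((√(1 + t))⁻¹ * |D|⁻¹) := by field_simp; norm_num
        have e2 : 2 * ((√t)⁻¹ * p⁻¹) * (π / (p * |b|)) = 4 * π * ((√t)⁻¹ * |D|⁻¹) := by
          have : 2 * ((√t)⁻¹ * p⁻¹) * (π / (p * |b|)) = 2 * π * (√t)⁻¹ * |b|⁻¹ * (p ^ 2)⁻¹ := by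
            field_simp
          rw [this, hp2]; field_simp; norm_num
        rw [e1, e2]
        calc _ ≤ 4 * √(8 * π * M) * ((√t)⁻¹ * (√t)⁻¹) + 4 * π * ((√t)⁻¹ * (√t)⁻¹) := by gcongr
          _ = (4 * √(8 * π * M) + 4 * π) * ((√t)⁻¹ * (√t)⁻¹) := by ring
          _ ≤ (4 * √(8 * π * M) + 4 * π) * (2 * (1 + t)⁻¹) := by gcongr
          _ = _ := by ring

theorem inv_sqrt_sub_le {s t : ℝ} (ht : 0 < t) (hst : s ≤ t / 2) :
    (√(t - s))⁻¹ ≤ 2 * (√t)⁻¹ := by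
  have h : √t ≤ 2 * √(t - s) := by
    refine sqrt_le_iff.2 ⟨by positivity, ?_⟩
    rw [mul_pow, sq_sqrt (by linarith)]
    linarith
  rw [← div_eq_mul_inv, le_div_iff₀ (sqrt_pos.2 ht), inv_mul_le_iff₀ (sqrt_pos.2 (by linarith))]
  linarith

theorem convMajorant_le_late {M t s : ℝ} (hM : 0 < M) (hs : t / 2 ≤ s) (ht : 0 < t) (hst : s < t)
    (E : ℝ) :
    convMajorant M t E s ≤ 6 * ((√(1 + t))⁻¹ * (1 + t)⁻¹ * (√(t - s))⁻¹) := by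
  have hs0 : 0 < s := by linarith
  have hT : 0 < t - s := sub_pos.2 hst
  have h4 : exp (-(E ^ 2 / (8 * (M * (t - s))))) ≤ 1 := by
    apply exp_le_one_iff.2
    have : 0 ≤ E ^ 2 / (8 * (M * (t - s))) := by positivity
    linarith
  have h1 : (1 + s)⁻¹ ≤ 2 * (1 + t)⁻¹ := by
    rw [← div_eq_mul_inv, le_div_iff₀ (by linarith), inv_mul_le_iff₀ (by linarith)]
    linarith
  have h2 : (√(1 + s))⁻¹ ≤ 2 * (√(1 + t))⁻¹ := by
    have := inv_sqrt_sub_le (t := 1 + t) (s := t - s) (by linarith) (by linarith)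
    rwa [show 1 + t - (t - s) = 1 + s by ring] at this
  have h3 : ((1 + |E| + √s) ^ 3)⁻¹ ≤ (1 + s)⁻¹ * (√(1 + s))⁻¹ := by
    refine (inv_cube_le_inv_sqrt_cube hs0.le (abs_nonneg E)).trans_eq ?_
    rw [← mul_inv, pow_succ, sq_sqrt (by linarith)]
  rw [convMajorant]
  calc _ ≤ (√(1 + t))⁻¹ * (√(t - s))⁻¹ * (2 * (1 + t)⁻¹) * 1 +
        (√(t - s))⁻¹ * (2 * (1 + t)⁻¹ * (2 * (√(1 + t))⁻¹)) := by gcongr; exact h3.trans (by gcongr)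
    _ = _ := by ring

theorem convMajorant_le_nonresonant {M t s E D : ℝ} (hM : 0 < M) (hs : 0 < s) (hst : s ≤ t / 2)
    (hE : |D| ≤ 2 * |E|) :
    convMajorant M t E s ≤ (√(1 + t))⁻¹ * exp (-(D ^ 2 / (32 * (M * t)))) *
        ((√(t - s))⁻¹ * (1 + s)⁻¹) +
      2 * (√t)⁻¹ * (√((1 + |D| / 2) ^ 2 + s) ^ 3)⁻¹ := by
  have ht : 0 < t := by linarith
  have hT : 0 < t - s := by linarith
  have hE0 := abs_nonneg D
  have hr := sqrt_nonneg s
  have h1 : exp (-(E ^ 2 / (8 * (M * (t - s))))) ≤ exp (-(D ^ 2 / (32 * (M * t)))) := by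
    refine (exp_neg_div_le hM (by norm_num) hs.le (by linarith)).trans ?_
    rw [exp_le_exp, ← sq_abs E, ← sq_abs D]
    have : (|D| / 2) ^ 2 / (8 * (M * t)) ≤ |E| ^ 2 / (8 * (M * t)) := by
      gcongr
      linarith
    have e : (|D| / 2) ^ 2 / (8 * (M * t)) = |D| ^ 2 / (32 * (M * t)) := by
      field_simp; ring
    linarith
  have h2 : ((1 + |E| + √s) ^ 3)⁻¹ ≤ (√((1 + |D| / 2) ^ 2 + s) ^ 3)⁻¹ := by
    apply inv_anti₀ (by positivity)
    have : √((1 + |D| / 2) ^ 2 + s) ≤ 1 + |E| + √s := by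
      calc √((1 + |D| / 2) ^ 2 + s) ≤ 1 + |D| / 2 + √s := by
            refine sqrt_le_iff.2 ⟨by positivity, ?_⟩
            nlinarith [sq_sqrt hs.le, mul_nonneg hE0 hr]
        _ ≤ _ := by linarith
    gcongr
  have h3 := inv_sqrt_sub_le ht hst
  rw [convMajorant]
  calc _ ≤ (√(1 + t))⁻¹ * (√(t - s))⁻¹ * (1 + s)⁻¹ * exp (-(D ^ 2 / (32 * (M * t)))) +
        (2 * (√t)⁻¹) * (√((1 + |D| / 2) ^ 2 + s) ^ 3)⁻¹ := by gcongr
    _ = _ := by ring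

theorem convMajorant_le_resonant {M t s b D : ℝ} (hM : 0 < M) (hs : 0 < s) (hst : s ≤ t / 2)
    (hD : 0 < |D|) (hE : 2 * |D + b * s| ≤ |D|) :
    convMajorant M t (D + b * s) s ≤ 2 * ((√(1 + t))⁻¹ * (√t)⁻¹ * (2 * |b| / |D|) *
        exp (-((D + b * s) ^ 2 / (8 * (M * t)))) +
        (√t)⁻¹ * ((√(|D| / (2 * |b|)))⁻¹ *
          (√(|D| / (2 * |b|)) ^ 2 + (D + b * s) ^ 2)⁻¹)) := by
  have ht : 0 < t := by linarith
  have hT : 0 < t - s := by linarith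
  have h1 : |D| ≤ 2 * |b| * s := by
    have h : |D| ≤ |D + b * s| + |b * s| := by
      simpa using abs_sub (D + b * s) (b * s)
    rw [abs_mul, abs_of_pos hs] at h
    linarith
  have hb : 0 < |b| := by
    by_contra hb
    have : |b| = 0 := le_antisymm (not_lt.1 hb) (abs_nonneg b)
    rw [this] at h1
    linarith
  have h2 : |D| / (2 * |b|) ≤ s := by rw [div_le_iff₀ (by positivity)]; linarith
  have h3 : (1 + s)⁻¹ ≤ 2 * |b| / |D| := by
    rw [← inv_div]
    apply inv_anti₀ (by positivity)
    linarith
  set p := √(|D| / (2 * |b|)) with hp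
  have hpp : 0 < p := sqrt_pos.2 (by positivity)
  have h4 : p ≤ √s := sqrt_le_sqrt h2
  have h5 : ((1 + |D + b * s| + √s) ^ 3)⁻¹ ≤ p⁻¹ * (p ^ 2 + (D + b * s) ^ 2)⁻¹ := by
    refine le_trans (inv_anti₀ (by positivity) ?_) (inv_cube_le_cauchy hpp _)
    have : p + |D + b * s| ≤ 1 + |D + b * s| + √s := by linarith
    gcongr
  have h6 := inv_sqrt_sub_le ht hst
  have h7 := exp_neg_div_le (E := D + b * s) hM (show (0 : ℝ) < 8 by norm_num) hs.le
    (show s < t by linarith)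
  rw [convMajorant]
  calc _ ≤ (√(1 + t))⁻¹ * (2 * (√t)⁻¹) * (2 * |b| / |D|) *
        exp (-((D + b * s) ^ 2 / (8 * (M * t)))) +
        (2 * (√t)⁻¹) * (p⁻¹ * (p ^ 2 + (D + b * s) ^ 2)⁻¹) := by gcongr
    _ = _ := by ring

theorem lintegral_convMajorant_le_of_sqrt_le {M t b D : ℝ} (hM : 0 < M) (ht : 1 ≤ t)
    (hD : √t ≤ |D|) :
    ∫⁻ s in Set.Ioo 0 t, ENNReal.ofReal (convMajorant M t (D + b * s) s) ≤
      ENNReal.ofReal (4 * ((√(1 + t))⁻¹ * exp (-(D ^ 2 / (32 * (M * t))))) +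
        (28 + (8 * √(8 * π * M) + 8 * π)) * (1 + t)⁻¹) := by
  have ht0 : 0 < t := by linarith
  have hrt : 0 < √t := sqrt_pos.2 ht0
  have hDp : 0 < |D| := hrt.trans_le hD
  have htt : √t * √t = t := mul_self_sqrt ht0.le
  have hti : (√t)⁻¹ * (√t)⁻¹ ≤ 2 * (1 + t)⁻¹ := by
    rw [← mul_inv, htt, ← div_eq_mul_inv, le_div_iff₀ (by linarith), inv_mul_le_iff₀ ht0]
    linarith
  let P₁ : ℝ → ENNReal := fun s =>
    ENNReal.ofReal (6 * ((√(1 + t))⁻¹ * (1 + t)⁻¹)) * ENNReal.ofReal ((√(t - s))⁻¹)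
  let P₂ : ℝ → ENNReal := fun s =>
    ENNReal.ofReal ((√(1 + t))⁻¹ * exp (-(D ^ 2 / (32 * (M * t))))) *
      ENNReal.ofReal ((√(t - s))⁻¹ * (1 + s)⁻¹)
  let P₃ : ℝ → ENNReal := fun s =>
    ENNReal.ofReal (2 * (√t)⁻¹) * ENNReal.ofReal ((√((1 + |D| / 2) ^ 2 + s) ^ 3)⁻¹)
  let P₄ : ℝ → ENNReal := fun s =>
    ENNReal.ofReal (2 * ((√(1 + t))⁻¹ * (√t)⁻¹ * (2 * |b| / |D|) *
        exp (-((D + b * s) ^ 2 / (8 * (M * t)))) +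
        (√t)⁻¹ * ((√(|D| / (2 * |b|)))⁻¹ *
          (√(|D| / (2 * |b|)) ^ 2 + (D + b * s) ^ 2)⁻¹)))
  have m₁ : Measurable P₁ := by fun_prop
  have m₂ : Measurable P₂ := by fun_prop
  have m₃ : Measurable P₃ := by fun_prop
  have i₁ : ∫⁻ s in Set.Ioo 0 t, P₁ s ≤ ENNReal.ofReal (12 * (1 + t)⁻¹) := by
    rw [lintegral_const_mul _ (by fun_prop), lintegral_inv_sqrt_sub ht0,
      ← ENNReal.ofReal_mul (by positivity)]
    apply ENNReal.ofReal_le_ofReal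
    have : (√(1 + t))⁻¹ * √t ≤ 1 := by
      rw [inv_mul_le_iff₀ (by positivity), mul_one]
      exact sqrt_le_sqrt (by linarith)
    calc _ = 12 * (1 + t)⁻¹ * ((√(1 + t))⁻¹ * √t) := by ring
      _ ≤ 12 * (1 + t)⁻¹ * 1 := by gcongr
      _ = _ := mul_one _
  have i₂ : ∫⁻ s in Set.Ioo 0 t, P₂ s ≤
      ENNReal.ofReal (4 * ((√(1 + t))⁻¹ * exp (-(D ^ 2 / (32 * (M * t)))))) := by
    rw [lintegral_const_mul _ (by fun_prop)]
    refine (mul_le_mul' le_rfl (lintegral_inv_sqrt_mul_inv_le ht0)).trans_eq ?_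
    rw [← ENNReal.ofReal_mul (by positivity), mul_comm]
  have i₃ : ∫⁻ s in Set.Ioo 0 t, P₃ s ≤ ENNReal.ofReal (16 * (1 + t)⁻¹) := by
    rw [lintegral_const_mul _ (by fun_prop)]
    calc _ ≤ ENNReal.ofReal (2 * (√t)⁻¹) * ENNReal.ofReal (2 / (1 + |D| / 2)) := by
          gcongr
          exact lintegral_rpow_shift (by positivity)
      _ ≤ _ := by
          rw [← ENNReal.ofReal_mul (by positivity)]
          apply ENNReal.ofReal_le_ofReal
          have : 2 / (1 + |D| / 2) ≤ 4 * (√t)⁻¹ := by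
            rw [← div_eq_mul_inv, div_le_div_iff₀ (by positivity) hrt]
            linarith
          calc _ ≤ 2 * (√t)⁻¹ * (4 * (√t)⁻¹) := by gcongr
            _ = 8 * ((√t)⁻¹ * (√t)⁻¹) := by ring
            _ ≤ 8 * (2 * (1 + t)⁻¹) := by gcongr
            _ = _ := by ring
  have i₄ : ∫⁻ s in Set.Ioo 0 t, P₄ s ≤
      ENNReal.ofReal ((8 * √(8 * π * M) + 8 * π) * (1 + t)⁻¹) :=
    (setLIntegral_le_lintegral _ _).trans (lintegral_resonant_le hM ht hD)
  calc _ ≤ ∫⁻ s in Set.Ioo 0 t, (P₁ s + (P₂ s + (P₃ s + P₄ s))) := by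
        refine setLIntegral_mono' measurableSet_Ioo fun s hs => ?_
        have hs0 := hs.1
        have hT : 0 < t - s := sub_pos.2 hs.2
        rcases le_total (t / 2) s with h | h
        · refine le_trans ?_ le_self_add
          simp only [P₁]
          rw [← ENNReal.ofReal_mul (by positivity)]
          apply ENNReal.ofReal_le_ofReal
          exact (convMajorant_le_late hM h ht0 hs.2 _).trans_eq (by ring)
        · refine le_trans ?_ le_add_self
          rw [← add_assoc]
          rcases le_total |D| (2 * |D + b * s|) with h' | h'
          · refine le_trans ?_ le_self_add
            simp only [P₂, P₃]
            rw [← ENNReal.ofReal_mul (by positivity), ← ENNReal.ofReal_mul (by positivity),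
              ← ENNReal.ofReal_add (by positivity) (by positivity)]
            exact ENNReal.ofReal_le_ofReal (convMajorant_le_nonresonant hM hs0 h h')
          · refine le_trans ?_ le_add_self
            exact ENNReal.ofReal_le_ofReal (convMajorant_le_resonant hM hs0 h hDp h')
    _ ≤ ENNReal.ofReal (12 * (1 + t)⁻¹) +
        (ENNReal.ofReal (4 * ((√(1 + t))⁻¹ * exp (-(D ^ 2 / (32 * (M * t)))))) +
          (ENNReal.ofReal (16 * (1 + t)⁻¹) +
            ENNReal.ofReal ((8 * √(8 * π * M) + 8 * π) * (1 + t)⁻¹))) := by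
        rw [lintegral_add_left m₁, lintegral_add_left m₂, lintegral_add_left m₃]
        gcongr
    _ = _ := by
        rw [← ENNReal.ofReal_add (by positivity) (by positivity),
          ← ENNReal.ofReal_add (by positivity) (by positivity),
          ← ENNReal.ofReal_add (by positivity) (by positivity)]
        congr 1; ring

theorem theta_nonneg (m : ℕ) (a : Fin m → ℝ) (M' x : ℝ) {t : ℝ} (ht : 0 < t) :
    0 ≤ theta m a M' x t :=
  Finset.sum_nonneg fun _ _ => by positivity

theorem chi_le_one (a1 am x t : ℝ) : chi a1 am x t ≤ 1 := by
  unfold chi; split_ifs <;> norm_num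

theorem chi_nonneg (a1 am x t : ℝ) : 0 ≤ chi a1 am x t := by
  unfold chi; split_ifs <;> norm_num

theorem psi1_nonneg (m : ℕ) (a : Fin m → ℝ) (a1 am x : ℝ) {t : ℝ} (ht : 0 < t) :
    0 ≤ psi1 m a a1 am x t :=
  mul_nonneg (chi_nonneg _ _ _ _) (Finset.sum_nonneg fun _ _ => by positivity)

theorem psi2_nonneg (a1 am x t : ℝ) : 0 ≤ psi2 a1 am x t :=
  mul_nonneg (sub_nonneg.2 (chi_le_one _ _ _ _)) (by positivity)

theorem le_theta {m : ℕ} (a : Fin m → ℝ) (M' x : ℝ) {t : ℝ} (ht : 0 < t) (k : Fin m) :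
    (√(1 + t))⁻¹ * exp (-((x - a k * t) ^ 2 / (M' * t))) ≤ theta m a M' x t := by
  have e : (√(1 + t))⁻¹ = (1 + t) ^ (-(1/2 : ℝ)) := by
    rw [rpow_neg (by linarith), sqrt_eq_rpow]
  rw [e]
  exact Finset.single_le_sum
    (f := fun j => (1 + t) ^ (-(1/2 : ℝ)) * exp (-((x - a j * t) ^ 2 / (M' * t))))
    (fun _ _ => by positivity) (Finset.mem_univ k)

theorem le_psi1 {m : ℕ} (a : Fin m → ℝ) {lo hi : ℝ} {x t : ℝ} (ht : 0 < t) (k : Fin m)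
    (hk : lo ≤ a k) (hk' : a k ≤ hi) (h1 : lo * t ≤ x) (h2 : x ≤ hi * t) :
    ((1 + 2 * (|lo| + |hi|)) * (1 + t))⁻¹ ≤ psi1 m a lo hi x t := by
  set A := |lo| + |hi| with hA
  have hA0 : 0 ≤ A := by positivity
  have hlo : -A ≤ lo := by
    have := neg_abs_le lo
    have := abs_nonneg hi
    linarith
  have hhi : hi ≤ A := by
    have := le_abs_self hi
    have := abs_nonneg lo
    linarith
  have hx : |x| ≤ A * t := abs_le.2 ⟨by nlinarith, by nlinarith⟩
  have hxk : |x - a k * t| ≤ 2 * A * t := abs_le.2 ⟨by nlinarith, by nlinarith⟩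
  have hq : 0 < (1 + 2 * A) * (1 + t) := by positivity
  have hAt : 0 ≤ A * t := by positivity
  have key : ∀ u, 0 < u → u ≤ (1 + 2 * A) * (1 + t) →
      ((1 + 2 * A) * (1 + t)) ^ (-(1/2 : ℝ)) ≤ u ^ (-(1/2 : ℝ)) := fun u hu hu' =>
    rpow_le_rpow_of_nonpos hu hu' (by norm_num)
  have e : ((1 + 2 * A) * (1 + t))⁻¹ =
      ((1 + 2 * A) * (1 + t)) ^ (-(1/2 : ℝ)) * ((1 + 2 * A) * (1 + t)) ^ (-(1/2 : ℝ)) := by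
    rw [← rpow_add hq]
    norm_num [rpow_neg_one]
  rw [psi1, chi, if_pos ⟨h1, h2⟩, one_mul, e]
  refine le_trans ?_ (Finset.single_le_sum
    (f := fun j => (1 + |x| + t) ^ (-(1/2 : ℝ)) * (1 + |x - a j * t|) ^ (-(1/2 : ℝ)))
    (fun _ _ => by positivity) (Finset.mem_univ k))
  exact mul_le_mul (key _ (by positivity) (by nlinarith)) (key _ (by positivity) (by nlinarith))
    (by positivity) (by positivity)

theorem le_psi2 {lo hi x t : ℝ} (h : ¬ (lo * t ≤ x ∧ x ≤ hi * t)) :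
    (1 + |x - lo * t| + √t) ^ (-(3/2 : ℝ)) ≤ psi2 lo hi x t ∧
      (1 + |x - hi * t| + √t) ^ (-(3/2 : ℝ)) ≤ psi2 lo hi x t := by
  rw [psi2, chi, if_neg h, sub_zero, one_mul]
  have h1 : 0 ≤ (1 + |x - lo * t| + √t) ^ (-(3/2 : ℝ)) := by positivity
  have h2 : 0 ≤ (1 + |x - hi * t| + √t) ^ (-(3/2 : ℝ)) := by positivity
  constructor <;> linarith

theorem psi2_sq_le (lo hi y s : ℝ) :
    psi2 lo hi y s ^ 2 ≤
      2 * (((1 + |y - lo * s| + √s) ^ 3)⁻¹ + ((1 + |y - hi * s| + √s) ^ 3)⁻¹) := by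
  have e : ∀ c, ((1 + |y - c * s| + √s) ^ 3)⁻¹ =
      ((1 + |y - c * s| + √s) ^ (-(3/2 : ℝ))) ^ 2 := by
    intro c
    have hp : 0 < 1 + |y - c * s| + √s := by positivity
    rw [← rpow_natCast (_ ^ (-(3/2 : ℝ))), ← rpow_mul hp.le]
    norm_num [rpow_neg hp.le]
  rw [e, e, psi2, mul_pow]
  set u := (1 + |y - lo * s| + √s) ^ (-(3/2 : ℝ))
  set v := (1 + |y - hi * s| + √s) ^ (-(3/2 : ℝ))
  have h1 := chi_nonneg lo hi y s
  have h2 := chi_le_one lo hi y s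
  have h3 : (1 - chi lo hi y s) ^ 2 ≤ 1 := by nlinarith
  nlinarith [sq_nonneg (u - v), mul_le_mul_of_nonneg_right h3 (sq_nonneg (u + v))]

theorem lintegral_convMajorant_le_near {M t D : ℝ} (hM : 0 < M) (ht : 0 < t)
    (hD : |D| ≤ √t) (E : ℝ → ℝ) :
    ∫⁻ s in Set.Ioo 0 t, ENNReal.ofReal (convMajorant M t (E s) s) ≤
      ENNReal.ofReal (10 * exp (1 / (32 * M)) *
        ((√(1 + t))⁻¹ * exp (-(D ^ 2 / (32 * M * t))))) := by
  refine (lintegral_convMajorant_le hM ht E).trans (ENNReal.ofReal_le_ofReal ?_)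
  have h1 : D ^ 2 ≤ t := by
    rw [← sq_abs, ← sq_sqrt ht.le]
    gcongr
  have h2 : 1 ≤ exp (1 / (32 * M)) * exp (-(D ^ 2 / (32 * M * t))) := by
    rw [← exp_add, one_le_exp_iff]
    have : D ^ 2 / (32 * M * t) ≤ t / (32 * M * t) := by gcongr
    have e : t / (32 * M * t) = 1 / (32 * M) := by field_simp
    linarith
  calc _ = 10 * (√(1 + t))⁻¹ * 1 := by ring
    _ ≤ 10 * (√(1 + t))⁻¹ * (exp (1 / (32 * M)) * exp (-(D ^ 2 / (32 * M * t)))) := by gcongr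
    _ = _ := by ring

theorem sqrt_mul_inv_cube_le {t d : ℝ} (hd : √t ≤ d) :
    √t * ((1 + d) ^ 3)⁻¹ ≤ 8 * (1 + d + √t) ^ (-(3/2 : ℝ)) := by
  have hr := sqrt_nonneg t
  have hd0 : 0 ≤ d := hr.trans hd
  set u := 1 + d + √t with hu
  have hu1 : 1 ≤ u := by linarith
  have hu0 : 0 < u := by linarith
  have h1 : ((1 + d) ^ 3)⁻¹ ≤ 8 * (u ^ 3)⁻¹ := by
    have e : 8 * (u ^ 3)⁻¹ = ((u / 2) ^ 3)⁻¹ := by rw [div_pow, inv_div]; ring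
    rw [e]
    apply inv_anti₀ (by positivity)
    have : u / 2 ≤ 1 + d := by linarith
    gcongr
  have h2 : u * (u ^ 3)⁻¹ ≤ u ^ (-(3/2 : ℝ)) := by
    have e : u * (u ^ 3)⁻¹ = u ^ (-2 : ℝ) := by
      rw [rpow_neg hu0.le]; norm_num; field_simp
    rw [e]
    exact rpow_le_rpow_of_exponent_le hu1 (by norm_num)
  calc _ ≤ u * (8 * (u ^ 3)⁻¹) := by gcongr; linarith
    _ = 8 * (u * (u ^ 3)⁻¹) := by ring
    _ ≤ _ := by gcongr

theorem lintegral_convMajorant_le_outside {M t D : ℝ} (hM : 0 < M) (ht : 0 < t)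
    (E : ℝ → ℝ) (hE : ∀ s ∈ Set.Ioo 0 t, |D| ≤ |E s|) :
    ∫⁻ s in Set.Ioo 0 t, ENNReal.ofReal (convMajorant M t (E s) s) ≤
      ENNReal.ofReal (10 * exp (1 / (32 * M)) *
        ((√(1 + t))⁻¹ * exp (-(D ^ 2 / (32 * M * t)))) +
        16 * (1 + |D| + √t) ^ (-(3/2 : ℝ))) := by
  rcases le_total |D| √t with h | h
  · refine (lintegral_convMajorant_le_near hM ht h E).trans (ENNReal.ofReal_le_ofReal ?_)
    have : 0 ≤ 16 * (1 + |D| + √t) ^ (-(3/2 : ℝ)) := by positivity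
    linarith
  · refine (lintegral_convMajorant_le_of_le_abs hM ht (abs_nonneg D) E hE).trans
      (ENNReal.ofReal_le_ofReal ?_)
    have h1 := sqrt_mul_inv_cube_le h
    have h2 : exp (-(|D| ^ 2 / (8 * (M * t)))) ≤ exp (-(D ^ 2 / (32 * M * t))) := by
      rw [exp_le_exp, sq_abs, neg_le_neg_iff]
      have : 0 < M * t := by positivity
      exact div_le_div_of_nonneg_left (sq_nonneg D) (by positivity) (by linarith)
    have h3 : 1 ≤ exp (1 / (32 * M)) := one_le_exp (by positivity)
    calc _ ≤ 4 * ((√(1 + t))⁻¹ * exp (-(D ^ 2 / (32 * M * t)))) +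
          2 * (8 * (1 + |D| + √t) ^ (-(3/2 : ℝ))) := by gcongr
      _ ≤ 10 * exp (1 / (32 * M)) * ((√(1 + t))⁻¹ * exp (-(D ^ 2 / (32 * M * t)))) +
          2 * (8 * (1 + |D| + √t) ^ (-(3/2 : ℝ))) := by gcongr; linarith
      _ = _ := by ring

theorem exists_lintegral_convMajorant_le {m : ℕ} (a : Fin m → ℝ) {lo hi : Fin m}
    (hlo : ∀ k, a lo ≤ a k) (hhi : ∀ k, a k ≤ a hi) {M : ℝ} (hM : 0 < M) (j k : Fin m) :
    ∃ C > 0, ∀ x t : ℝ, 0 < t →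
      ∫⁻ s in Set.Ioo 0 t, ENNReal.ofReal (convMajorant M t (x - a j * (t - s) - a k * s) s) ≤
        ENNReal.ofReal (C * (theta m a (32 * M) x t + psi1 m a (a lo) (a hi) x t +
          psi2 (a lo) (a hi) x t)) := by
  set A := 1 + 2 * (|a lo| + |a hi|) with hA
  have hA0 : 0 < A := by positivity
  set K := 28 + (8 * √(8 * π * M) + 8 * π) with hK
  have hK0 : 0 < K := by positivity
  refine ⟨10 * exp (1 / (32 * M)) + 16 + (20 + K) * A, by positivity, fun x t ht => ?_⟩
  set C := 10 * exp (1 / (32 * M)) + 16 + (20 + K) * A with hC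
  have hKA : 0 < (20 + K) * A := by positivity
  have hexp := exp_pos (1 / (32 * M))
  have hC1 : 10 * exp (1 / (32 * M)) ≤ C := by linarith
  have hC2 : 16 ≤ C := by linarith
  have hC3 : (20 + K) * A ≤ C := by linarith
  have hθ := theta_nonneg m a (32 * M) x ht
  have h₁ := psi1_nonneg m a (a lo) (a hi) x ht
  have h₂ := psi2_nonneg (a lo) (a hi) x t
  set Θ := theta m a (32 * M) x t
  set Ψ₁ := psi1 m a (a lo) (a hi) x t
  set Ψ₂ := psi2 (a lo) (a hi) x t
  have hC0 : 0 ≤ C := by linarith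
  have hθl : ∀ i, (√(1 + t))⁻¹ * exp (-((x - a i * t) ^ 2 / (32 * M * t))) ≤ Θ :=
    le_theta a (32 * M) x ht
  have outside : ∀ i, (∀ s ∈ Set.Ioo 0 t, |x - a i * t| ≤ |x - a j * (t - s) - a k * s|) →
      (1 + |x - a i * t| + √t) ^ (-(3/2 : ℝ)) ≤ Ψ₂ →
      ∫⁻ s in Set.Ioo 0 t, ENNReal.ofReal (convMajorant M t (x - a j * (t - s) - a k * s) s) ≤
        ENNReal.ofReal (C * (Θ + Ψ₁ + Ψ₂)) := by
    intro i hi hi'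
    refine (lintegral_convMajorant_le_outside hM ht _ hi).trans (ENNReal.ofReal_le_ofReal ?_)
    calc _ ≤ C * Θ + C * Ψ₂ := by
          gcongr
          exact hθl i
      _ ≤ C * (Θ + Ψ₁ + Ψ₂) := by linarith [mul_nonneg hC0 h₁]
  by_cases hin : a lo * t ≤ x ∧ x ≤ a hi * t
  · rcases le_total |x - a j * t| √t with hD | hD
    · refine (lintegral_convMajorant_le_near hM ht hD _).trans (ENNReal.ofReal_le_ofReal ?_)
      calc _ ≤ C * Θ := by
            gcongr
            exact hθl j
        _ ≤ _ := by linarith [mul_nonneg hC0 h₁, mul_nonneg hC0 h₂]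
    · have hψ : (1 + t)⁻¹ ≤ A * Ψ₁ := by
        have := le_psi1 a ht j (hlo j) (hhi j) hin.1 hin.2
        rw [mul_inv, inv_mul_le_iff₀ hA0] at this
        exact this
      rcases le_total t 1 with h1 | h1
      · refine (lintegral_convMajorant_le hM ht _).trans (ENNReal.ofReal_le_ofReal ?_)
        have h3 : (√(1 + t))⁻¹ ≤ 2 * (1 + t)⁻¹ := by
          have hr : √(1 + t) ≤ 2 := sqrt_le_iff.2 ⟨by norm_num, by linarith⟩
          have hr0 : 0 < √(1 + t) := by positivity
          have hr2 := sq_sqrt (show 0 ≤ 1 + t by linarith)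
          rw [← div_eq_mul_inv, le_div_iff₀ (by linarith), inv_mul_le_iff₀ hr0]
          nlinarith
        calc _ ≤ 10 * (2 * (A * Ψ₁)) := by gcongr; exact h3.trans (by gcongr)
          _ ≤ (20 + K) * A * Ψ₁ := by
              have : 0 ≤ K * A * Ψ₁ := by positivity
              linarith
          _ ≤ C * Ψ₁ := by gcongr
          _ ≤ _ := by linarith [mul_nonneg hC0 hθ, mul_nonneg hC0 h₂]
      · have hb := lintegral_convMajorant_le_of_sqrt_le (b := a j - a k) hM h1 hD
        have e : ∀ s, x - a j * t + (a j - a k) * s = x - a j * (t - s) - a k * s := fun s => by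
          ring
        simp_rw [e] at hb
        refine hb.trans (ENNReal.ofReal_le_ofReal ?_)
        rw [← mul_assoc 32 M t]
        calc _ ≤ C * Θ + K * (A * Ψ₁) := by
              gcongr
              · linarith
              · exact hθl j
          _ ≤ C * Θ + (20 + K) * A * Ψ₁ := by
              have : 0 ≤ 20 * A * Ψ₁ := by positivity
              linarith
          _ ≤ C * Θ + C * Ψ₁ := by gcongr
          _ ≤ _ := by linarith [mul_nonneg hC0 h₂]
  · have hψ := le_psi2 hin
    rcases lt_or_ge x (a lo * t) with hx | hx
    · refine outside lo (fun s hs => ?_) hψ.1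
      have h3 := mul_le_mul_of_nonneg_right (hlo j) (sub_pos.2 hs.2).le
      have h4 := mul_le_mul_of_nonneg_right (hlo k) hs.1.le
      rw [abs_of_neg (by linarith), abs_of_neg (by linarith)]
      linarith
    · have hx' : a hi * t < x := by
        by_contra h
        exact hin ⟨hx, not_lt.1 h⟩
      refine outside hi (fun s hs => ?_) hψ.2
      have h3 := mul_le_mul_of_nonneg_right (hhi j) (sub_pos.2 hs.2).le
      have h4 := mul_le_mul_of_nonneg_right (hhi k) hs.1.le
      rw [abs_of_pos (by linarith), abs_of_pos (by linarith)]
      linarith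

theorem integral_integral_le_of_lintegral {f : ℝ → ℝ → ℝ} {t R : ℝ} (ht : 0 ≤ t) (hR : 0 ≤ R)
    (hf : ∀ s ∈ Set.Ioo 0 t, ∀ y, 0 ≤ f s y)
    (h : ∫⁻ s in Set.Ioo 0 t, ∫⁻ y, ENNReal.ofReal (f s y) ≤ ENNReal.ofReal R) :
    ∫ s in (0 : ℝ)..t, ∫ y, f s y ≤ R := by
  rw [intervalIntegral.integral_of_le ht, integral_Ioc_eq_integral_Ioo,
    ← ENNReal.ofReal_le_ofReal_iff hR]
  refine le_trans ?_ h
  refine (ofReal_le_enorm _).trans ((enorm_integral_le_lintegral_enorm _).trans ?_)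
  refine setLIntegral_mono' measurableSet_Ioo fun s hs => ?_
  refine (enorm_integral_le_lintegral_enorm _).trans (lintegral_mono fun y => ?_)
  rw [Real.enorm_of_nonneg (hf s hs y)]

/-- Nonlinear interaction estimate for the outside-cone part `ψ₂²`. -/
theorem nonlinear_estimate_psi2 (m : ℕ) (hm : 2 ≤ m) (a : Fin m → ℝ) (ha : StrictMono a)
    (ha1 : a ⟨0, by omega⟩ ≤ 0) (ham : 0 ≤ a ⟨m - 1, by omega⟩)
    (M : ℝ) (hM : 0 < M) :
    ∃ M' > M, ∃ C > 0, ∀ x t : ℝ, 0 < t →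
      (∫ s in (0 : ℝ)..t, ∫ y : ℝ, (t - s)⁻¹ *
          (∑ j : Fin m, Real.exp (-((x - y - a j * (t - s)) ^ 2 / (M * (t - s))))) *
          (psi2 (a ⟨0, by omega⟩) (a ⟨m - 1, by omega⟩) y s) ^ 2)
        ≤ C * (theta m a M' x t +
            psi1 m a (a ⟨0, by omega⟩) (a ⟨m - 1, by omega⟩) x t +
            psi2 (a ⟨0, by omega⟩) (a ⟨m - 1, by omega⟩) x t) := by
  set lo : Fin m := ⟨0, by omega⟩ with hlo_def
  set hi : Fin m := ⟨m - 1, by omega⟩ with hhi_def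
  have hlo : ∀ k, a lo ≤ a k := fun k => ha.monotone (Nat.zero_le _)
  have hhi : ∀ k, a k ≤ a hi := fun k => ha.monotone (Nat.le_sub_one_of_lt k.2)
  choose C hC hI using fun j k => exists_lintegral_convMajorant_le a hlo hhi hM j k
  set B := 2 * π + 2 * √(2 * π * M) + 8 * √(π * M) with hB
  have hB0 : 0 < B := by positivity
  have hne : (Finset.univ : Finset (Fin m)).Nonempty := ⟨lo, Finset.mem_univ _⟩
  refine ⟨32 * M, by linarith, ∑ j, 2 * B * (C j lo + C j hi),
    Finset.sum_pos (fun j _ => by have := hC j lo; have := hC j hi; positivity) hne,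
    fun x t ht => ?_⟩
  have hR : 0 ≤ theta m a (32 * M) x t + psi1 m a (a lo) (a hi) x t + psi2 (a lo) (a hi) x t :=
    add_nonneg (add_nonneg (theta_nonneg _ _ _ _ ht) (psi1_nonneg _ _ _ _ _ ht))
      (psi2_nonneg _ _ _ _)
  set R := theta m a (32 * M) x t + psi1 m a (a lo) (a hi) x t + psi2 (a lo) (a hi) x t
  have hS : 0 ≤ ∑ j, 2 * B * (C j lo + C j hi) :=
    Finset.sum_nonneg fun j _ => by have := hC j lo; have := hC j hi; positivity
  refine integral_integral_le_of_lintegral ht.le (mul_nonneg hS hR) (fun s hs y => ?_) ?_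
  · have := sub_pos.2 hs.2
    positivity
  let G : ℝ → Fin m → Fin m → ℝ → ENNReal := fun s j k y =>
    ENNReal.ofReal ((t - s)⁻¹ * (exp (-((x - y - a j * (t - s)) ^ 2 / (M * (t - s)))) *
      ((1 + |y - a k * s| + √s) ^ 3)⁻¹))
  let N : Fin m → Fin m → ℝ → ENNReal := fun j k s =>
    ENNReal.ofReal (convMajorant M t (x - a j * (t - s) - a k * s) s)
  have hG : ∀ s j k, Measurable (G s j k) := fun s j k => by fun_prop
  have hN : ∀ j k, Measurable (N j k) := fun j k => by
    unfold N convMajorant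
    fun_prop
  have pointwise : ∀ s ∈ Set.Ioo 0 t, ∀ y, ENNReal.ofReal ((t - s)⁻¹ *
      (∑ j, exp (-((x - y - a j * (t - s)) ^ 2 / (M * (t - s))))) * psi2 (a lo) (a hi) y s ^ 2) ≤
      ∑ j, ENNReal.ofReal 2 * (G s j lo y + G s j hi y) := by
    intro s hs y
    have hs0 := hs.1
    have hT : 0 < t - s := sub_pos.2 hs.2
    simp only [G]
    simp_rw [← ENNReal.ofReal_add
      (show 0 ≤ (t - s)⁻¹ * (exp (-((x - y - a _ * (t - s)) ^ 2 / (M * (t - s)))) *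
        ((1 + |y - a lo * s| + √s) ^ 3)⁻¹) by positivity)
      (show 0 ≤ (t - s)⁻¹ * (exp (-((x - y - a _ * (t - s)) ^ 2 / (M * (t - s)))) *
        ((1 + |y - a hi * s| + √s) ^ 3)⁻¹) by positivity),
      ← ENNReal.ofReal_mul (show (0 : ℝ) ≤ 2 by norm_num)]
    rw [← ENNReal.ofReal_sum_of_nonneg fun j _ => by positivity]
    apply ENNReal.ofReal_le_ofReal
    calc _ ≤ (t - s)⁻¹ * (∑ j, exp (-((x - y - a j * (t - s)) ^ 2 / (M * (t - s))))) *
          (2 * (((1 + |y - a lo * s| + √s) ^ 3)⁻¹ + ((1 + |y - a hi * s| + √s) ^ 3)⁻¹)) := by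
          gcongr
          exact psi2_sq_le _ _ _ _
      _ = _ := by
          rw [Finset.mul_sum, Finset.sum_mul]
          exact Finset.sum_congr rfl fun j _ => by ring
  calc _ ≤ ∫⁻ s in Set.Ioo 0 t,
        ∑ j, ENNReal.ofReal 2 * (ENNReal.ofReal B * N j lo s + ENNReal.ofReal B * N j hi s) := by
        refine setLIntegral_mono' measurableSet_Ioo fun s hs => ?_
        refine (lintegral_mono (pointwise s hs)).trans ?_
        rw [lintegral_finsetSum _ fun j _ => by have := hG s j; fun_prop]
        refine Finset.sum_le_sum fun j _ => ?_
        have h1 := hG s j lo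
        have h2 := hG s j hi
        rw [lintegral_const_mul _ (by fun_prop), lintegral_add_left h1]
        simp only [N]
        rw [← ENNReal.ofReal_mul hB0.le, ← ENNReal.ofReal_mul hB0.le]
        gcongr
        · exact lintegral_gaussian_conv_le hM hs.1 hs.2 x (a j) (a lo)
        · exact lintegral_gaussian_conv_le hM hs.1 hs.2 x (a j) (a hi)
    _ ≤ ∑ j, ENNReal.ofReal 2 * (ENNReal.ofReal B * ENNReal.ofReal (C j lo * R) +
          ENNReal.ofReal B * ENNReal.ofReal (C j hi * R)) := by
        rw [lintegral_finsetSum _ fun j _ => by have := hN j; fun_prop]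
        refine Finset.sum_le_sum fun j _ => ?_
        have h1 := hN j lo
        have h2 := hN j hi
        rw [lintegral_const_mul _ (by fun_prop), lintegral_add_left (by fun_prop),
          lintegral_const_mul _ h1, lintegral_const_mul _ h2]
        gcongr
        · exact hI j lo x t ht
        · exact hI j hi x t ht
    _ = _ := by
        rw [Finset.sum_mul, ENNReal.ofReal_sum_of_nonneg fun j _ => by
          have := hC j lo; have := hC j hi; positivity]
        refine Finset.sum_congr rfl fun j _ => ?_
        have h1 := hC j lo
        have h2 := hC j hi
        rw [← ENNReal.ofReal_mul hB0.le, ← ENNReal.ofReal_mul hB0.le,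
          ← ENNReal.ofReal_add (by positivity) (by positivity),
          ← ENNReal.ofReal_mul (by norm_num)]
        congr 1; ring
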